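/- arXiv:2509.07086 — 5 statements merged into one kernel-verified Lean document; each statement's English description precedes it below -/
import Mathlib

section
/- Let m ≥ 2, n ≥ 1 and let W be a Hermitian matrix indexed by Fin m × Fin n over ℂ such that ⟨ψ, W ψ⟩ ≥ 0 for every ψ with SR(ψ) ≤ 2. Define the corner block We as the n×n matrix We(j,l) = W((m−1,j),(m−1,l)) and the off-diagonal block χ as the (m−1)n × n matrix χ((i,j),l) = W((i,j),(m−1,l)) for i < m−1. Then the kernel of We is contained in the kernel of χ: for every γ ∈ ℂ^n, We γ = 0 implies χ γ = 0 (equivalently, the range of χ† is contained in the range of We). -/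
open Matrix Kronecker ComplexOrder

/-- The Schmidt rank of a vector `ψ ∈ ℂ^(Fin m × Fin n)`: the rank of the associated
`m × n` matrix with `(i,j)` entry `ψ (i,j)`. -/
noncomputable def schmidtRank {m n : ℕ} (ψ : Fin m × Fin n → ℂ) : ℕ :=
  (Matrix.of fun i j => ψ (i, j) : Matrix (Fin m) (Fin n) ℂ).rank

/-- Rank-one outer product `v v*`. -/
def outer {d : Type*} (v : d → ℂ) : Matrix d d ℂ :=
  Matrix.of fun a b => v a * star (v b)

/-- `SNle ρ k` : the Schmidt number of `ρ` is at most `k`, i.e. `ρ` is a finite sum of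
outer products of vectors of Schmidt rank at most `k`. -/
def SNle {m n : ℕ} (ρ : Matrix (Fin m × Fin n) (Fin m × Fin n) ℂ) (k : ℕ) : Prop :=
  ∃ (T : ℕ) (v : Fin T → (Fin m × Fin n → ℂ)),
    (∀ t, schmidtRank (v t) ≤ k) ∧ ρ = ∑ t, outer (v t)

/-- Partial transpose on the second (B) subsystem. -/
def ptB {m n : ℕ} (ρ : Matrix (Fin m × Fin n) (Fin m × Fin n) ℂ) :
    Matrix (Fin m × Fin n) (Fin m × Fin n) ℂ :=
  Matrix.of fun p q => ρ (p.1, q.2) (q.1, p.2)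

/-- Partial transpose on the first (A) subsystem. -/
def ptA {m n : ℕ} (ρ : Matrix (Fin m × Fin n) (Fin m × Fin n) ℂ) :
    Matrix (Fin m × Fin n) (Fin m × Fin n) ℂ :=
  Matrix.of fun p q => ρ (q.1, p.2) (p.1, q.2)


open ComplexOrder

lemma aux_rank_add {m n : ℕ} (A B : Matrix (Fin m) (Fin n) ℂ) :
    (A + B).rank ≤ A.rank + B.rank := by
  unfold Matrix.rank
  refine le_trans (Submodule.finrank_mono ?_)
    (Submodule.finrank_add_le_finrank_add_finrank _ _)
  rintro _ ⟨x, rfl⟩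
  rw [mulVecLin_add, LinearMap.add_apply]
  exact Submodule.add_mem_sup ⟨x, rfl⟩ ⟨x, rfl⟩

lemma aux_quad {d : Type*} [Fintype d] [DecidableEq d] (W : Matrix d d ℂ) (hW : W.IsHermitian)
    (u : d → ℂ) (a : d) (h0 : star u ⬝ᵥ W.mulVec u = 0)
    (h : ∀ t c : ℂ, 0 ≤ star (t • u + c • Pi.single a 1) ⬝ᵥ W.mulVec (t • u + c • Pi.single a 1)) :
    W.mulVec u a = 0 := by
  set z := W.mulVec u a with hz
  have h1 : star u ⬝ᵥ W.mulVec (Pi.single a 1) = star z := by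
    have : star z = star (star (Pi.single a (1:ℂ)) ⬝ᵥ W.mulVec u) := by
      rw [hz, ← Pi.single_star]; simp
    rw [this, star_dotProduct, star_mulVec, hW.eq, dotProduct_mulVec]
  have h2 : star (Pi.single a (1:ℂ)) ⬝ᵥ W.mulVec u = z := by
    rw [hz, ← Pi.single_star]; simp
  have h3 : star (Pi.single a (1:ℂ)) ⬝ᵥ W.mulVec (Pi.single a 1) = W a a := by
    rw [← Pi.single_star]; simp
  have key : ∀ s : ℝ, 0 ≤ Complex.normSq z * ((W a a).re - 2 * s) := by
    intro s
    have := h (-(s:ℂ)) z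
    rw [mulVec_add, mulVec_smul, mulVec_smul, star_add, star_smul, star_smul] at this
    simp only [add_dotProduct, dotProduct_add, smul_dotProduct, dotProduct_smul, h0, h1, h2, h3]
      at this
    have h4 := (Complex.le_def.1 this).1
    simp [Complex.normSq_apply] at h4 ⊢
    have him : (W a a).im = 0 := by
      have := congrArg Complex.im (hW.apply a a)
      simp at this
      linarith
    nlinarith
  have k := key (((W a a).re + 1) / 2)
  have : Complex.normSq z = 0 := le_antisymm (by linarith) (Complex.normSq_nonneg z)
  exact Complex.normSq_eq_zero.1 this

/-- For a 2-block-positive Hermitian `W`, the kernel of the corner block `We` is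
contained in the kernel of the off-diagonal block `χ`. -/
theorem corner_kernel_subset_offdiagonal_kernel {m n : ℕ} (hm : 2 ≤ m) (hn : 1 ≤ n)
    (W : Matrix (Fin m × Fin n) (Fin m × Fin n) ℂ) (hW : W.IsHermitian)
    (hpos : ∀ ψ : Fin m × Fin n → ℂ, schmidtRank ψ ≤ 2 → 0 ≤ star ψ ⬝ᵥ W.mulVec ψ)
    (last : Fin m) (hlast : (last : ℕ) = m - 1)
    (We : Matrix (Fin n) (Fin n) ℂ) (hWe : ∀ j l, We j l = W (last, j) (last, l))
    (χ : Matrix (Fin (m - 1) × Fin n) (Fin n) ℂ)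
    (hχ : ∀ p l, χ p l = W (Fin.castLE (by omega : m - 1 ≤ m) p.1, p.2) (last, l)) :
    ∀ γ : Fin n → ℂ, We.mulVec γ = 0 → χ.mulVec γ = 0 := by
  intro γ hγ
  funext p
  set i : Fin m := Fin.castLE (by omega : m - 1 ≤ m) p.1 with hi
  let u : Fin m × Fin n → ℂ := fun q => if q.1 = last then γ q.2 else 0
  have hu : ∀ q, W.mulVec u q = ∑ l, W q (last, l) * γ l := by
    intro q
    simp only [mulVec, dotProduct, u, Fintype.sum_prod_type]
    rw [Finset.sum_eq_single last] <;> simp +contextual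
  have e : χ.mulVec γ p = W.mulVec u (i, p.2) := by
    rw [hu]
    simp only [mulVec, dotProduct, hχ, hi]
  rw [e]
  refine aux_quad W hW u (i, p.2) ?_ ?_
  · simp only [dotProduct]
    apply Finset.sum_eq_zero
    rintro ⟨q, j⟩ -
    by_cases hq : q = last
    · subst hq
      have := congrFun hγ j
      simp only [mulVec, dotProduct, hWe] at this
      rw [hu, this]; simp
    · simp [u, hq]
  · intro t c
    apply hpos
    have : (Matrix.of fun x y => (t • u + c • Pi.single (i, p.2) 1 : Fin m × Fin n → ℂ) (x, y) :
        Matrix (Fin m) (Fin n) ℂ) =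
        vecMulVec (Pi.single last t) γ + vecMulVec (Pi.single i c) (Pi.single p.2 1) := by
      ext x y
      simp only [of_apply, Pi.add_apply, Pi.smul_apply, smul_eq_mul, Matrix.add_apply,
        vecMulVec_apply, u, Pi.single_apply, Prod.mk.injEq]
      by_cases h1 : x = last <;> by_cases h2 : x = i <;> by_cases h3 : y = p.2 <;>
        simp [h1, h2, h3]
    unfold schmidtRank
    rw [this]
    refine (aux_rank_add _ _).trans ?_
    have a1 := rank_vecMulVec_le (Pi.single last t) γ
    have a2 := rank_vecMulVec_le (Pi.single i c) (Pi.single p.2 (1:ℂ))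
    omega
end

section
/- Let ρ be a positive semidefinite matrix indexed by Fin (m+1) × Fin n over ℂ, with core ρc (the compression of ρ to index pairs with first component < m), off-diagonal block χ((i,j),l) = ρ((i,j),(m,l)) for i < m, and corner block ρe(j,l) = ρ((m,j),(m,l)). Then there exists an n×n positive semidefinite matrix σ such that the matrix ρ' obtained from ρ by replacing the corner block ρe with ρe − σ is positive semidefinite with rank(ρ') = rank(ρc), and ρ = ρ' + ι(σ), where ι(σ) is σ extended by zeros to all index pairs whose first component equals m. (Every positive semidefinite local extension is the sum of a flat local extension and a positive semidefinite matrix supported on the extension level.) -/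
open Matrix Kronecker ComplexOrder

open scoped MatrixOrder Matrix.Norms.L2Operator in
theorem exists_factor {N : Type*} [Fintype N] [DecidableEq N] {M : Matrix N N ℂ}
    (hM : M.PosSemidef) : ∃ B : Matrix N N ℂ, M = Bᴴ * B :=
  CStarAlgebra.nonneg_iff_eq_star_mul_self.mp hM.nonneg

theorem exists_normal_eq {N a b : Type*} [Fintype N] [Fintype a] [Fintype b]
    (A : Matrix N a ℂ) (C : Matrix N b ℂ) : ∃ X : Matrix a b ℂ, Aᴴ * (C - A * X) = 0 := by
  have hle : LinearMap.range (Aᴴ * A).mulVecLin ≤ LinearMap.range (Aᴴ).mulVecLin := by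
    rw [Matrix.mulVecLin_mul]
    exact LinearMap.range_comp_le_range _ _
  have heq := Submodule.eq_of_le_of_finrank_eq hle (by
    change (Aᴴ * A).rank = (Aᴴ).rank
    rw [Matrix.rank_conjTranspose_mul_self, Matrix.rank_conjTranspose])
  have h : ∀ j : b, ∃ x : a → ℂ, (Aᴴ * A) *ᵥ x = Aᴴ *ᵥ (fun k => C k j) := by
    intro j
    have : Aᴴ *ᵥ (fun k => C k j) ∈ LinearMap.range (Aᴴ * A).mulVecLin := by
      rw [heq]
      exact ⟨_, rfl⟩
    exact this
  choose x hx using h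
  refine ⟨Matrix.of fun i j => x j i, ?_⟩
  rw [Matrix.mul_sub, ← Matrix.mul_assoc, sub_eq_zero]
  ext i j
  exact (congrFun (hx j) i).symm

/-- Every positive semidefinite local extension is the sum of a flat local extension and
a positive semidefinite matrix supported on the extension level. -/
theorem psd_extension_flat_plus_supported {m n : ℕ}
    (ρ : Matrix (Fin (m + 1) × Fin n) (Fin (m + 1) × Fin n) ℂ) (hρ : ρ.PosSemidef)
    (ρc : Matrix (Fin m × Fin n) (Fin m × Fin n) ℂ)
    (hc : ∀ p q : Fin m × Fin n, ρc p q = ρ (p.1.castSucc, p.2) (q.1.castSucc, q.2)) :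
    ∃ σ : Matrix (Fin n) (Fin n) ℂ, σ.PosSemidef ∧
      (ρ - Matrix.of fun p q : Fin (m + 1) × Fin n =>
          if p.1 = Fin.last m ∧ q.1 = Fin.last m then σ p.2 q.2 else 0).PosSemidef ∧
      (ρ - Matrix.of fun p q : Fin (m + 1) × Fin n =>
          if p.1 = Fin.last m ∧ q.1 = Fin.last m then σ p.2 q.2 else 0).rank
        = ρc.rank := by
  obtain ⟨B, hB⟩ : ∃ B : Matrix (Fin (m + 1) × Fin n) (Fin (m + 1) × Fin n) ℂ, ρ = Bᴴ * B := by
    exact exists_factor hρ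
  set A : Matrix (Fin (m + 1) × Fin n) (Fin m × Fin n) ℂ :=
    B.submatrix id (fun p => (p.1.castSucc, p.2)) with hA
  set C : Matrix (Fin (m + 1) × Fin n) (Fin n) ℂ :=
    B.submatrix id (fun j => (Fin.last m, j)) with hC
  obtain ⟨X, hX⟩ := exists_normal_eq A C
  set T := C - A * X with hT
  let P : Matrix (Fin m × Fin n) (Fin (m + 1) × Fin n) ℂ :=
    Matrix.of fun p q => if q = (p.1.castSucc, p.2) then 1 else 0
  let E : Matrix (Fin n) (Fin (m + 1) × Fin n) ℂ :=
    Matrix.of fun j q => if q = (Fin.last m, j) then 1 else 0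
  have hBd : B = A * P + C * E := by
    ext k ⟨i, j⟩
    refine Fin.lastCases ?_ (fun i => ?_) i
    · simp [Matrix.mul_apply, P, E, hA, hC, Fintype.sum_prod_type, (Fin.castSucc_lt_last _).ne']
    · simp [Matrix.mul_apply, P, E, hA, hC, Fintype.sum_prod_type, (Fin.castSucc_lt_last _).ne,
        ite_and]
  have hι : (Matrix.of fun p q : Fin (m + 1) × Fin n =>
      if p.1 = Fin.last m ∧ q.1 = Fin.last m then (Tᴴ * T) p.2 q.2 else 0)
      = (T * E)ᴴ * (T * E) := by
    have hTE : ∀ k q, (T * E) k q = if q.1 = Fin.last m then T k q.2 else 0 := by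
      rintro k ⟨i, j⟩
      by_cases h : i = Fin.last m <;> simp [Matrix.mul_apply, E, h]
    ext p q
    simp only [Matrix.of_apply, Matrix.mul_apply, Matrix.conjTranspose_apply]
    simp only [← Matrix.mul_apply, hTE]
    by_cases h : p.1 = Fin.last m <;> by_cases h' : q.1 = Fin.last m <;> simp [h, h']
  have hBW : B = A * (P + X * E) + T * E := by
    rw [hBd, hT, Matrix.sub_mul, Matrix.mul_add, Matrix.mul_assoc]
    abel
  have hX' : Tᴴ * A = 0 := by
    have := congrArg Matrix.conjTranspose hX
    simpa using this
  have hW : ρ - (T * E)ᴴ * (T * E) = (A * (P + X * E))ᴴ * (A * (P + X * E)) := by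
    have h1 : (A * (P + X * E))ᴴ * (T * E) = 0 := by
      rw [Matrix.conjTranspose_mul, Matrix.mul_assoc, ← Matrix.mul_assoc Aᴴ, hX]
      simp
    have h2 : (T * E)ᴴ * (A * (P + X * E)) = 0 := by
      rw [Matrix.conjTranspose_mul, Matrix.mul_assoc, ← Matrix.mul_assoc Tᴴ, hX']
      simp
    rw [hB, hBW]
    generalize A * (P + X * E) = W at h1 h2 ⊢
    rw [Matrix.conjTranspose_add, Matrix.add_mul, Matrix.mul_add, Matrix.mul_add, h1, h2]
    simp
  have hcA : ρc = Aᴴ * A := by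
    ext p q
    rw [hc, hB]
    simp [Matrix.mul_apply, hA]
  refine ⟨Tᴴ * T, Matrix.posSemidef_conjTranspose_mul_self T, ?_, ?_⟩
  · rw [hι, hW]
    exact Matrix.posSemidef_conjTranspose_mul_self _
  · apply le_antisymm
    · rw [hι, hW, hcA, Matrix.rank_conjTranspose_mul_self, Matrix.rank_conjTranspose_mul_self]
      exact Matrix.rank_mul_le_left _ _
    · have : ρc = (ρ - Matrix.of fun p q : Fin (m + 1) × Fin n =>
          if p.1 = Fin.last m ∧ q.1 = Fin.last m then (Tᴴ * T) p.2 q.2 else 0).submatrix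
          (fun p : Fin m × Fin n => (p.1.castSucc, p.2))
          (fun p : Fin m × Fin n => (p.1.castSucc, p.2)) := by
        ext p q
        simp [hc, (Fin.castSucc_lt_last _).ne]
      conv_lhs => rw [this]
      exact Matrix.rank_submatrix_le _ _ _
end

section
/- Let ρ be a positive semidefinite matrix indexed by Fin (m+1) × Fin n over ℂ with core ρc (the compression of ρ to index pairs with first component < m), and suppose rank(ρ) = rank(ρc) (ρ is a flat local extension). Then: (1) if v ∈ ℂ^(Fin (m+1) × Fin n) lies in the range of ρ and v(i,j) = 0 for all i < m, then v = 0; and (2) the image of the range of ρ under the truncation map v ↦ (v(i,j))_{i<m} equals the range of ρc. In particular, every vector of the range of ρc has a unique completion to a vector in the range of ρ. -/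
open Matrix Kronecker ComplexOrder

/-- For a flat local extension `ρ` of `ρc`: (1) no nonzero vector of the range of `ρ`
vanishes on the core levels, and (2) the truncation of the range of `ρ` equals the range
of `ρc`; hence every vector of the range of `ρc` has a unique completion. -/
theorem flat_extension_range_completion {m n : ℕ}
    (ρ : Matrix (Fin (m + 1) × Fin n) (Fin (m + 1) × Fin n) ℂ) (hρ : ρ.PosSemidef)
    (ρc : Matrix (Fin m × Fin n) (Fin m × Fin n) ℂ)
    (hc : ∀ p q : Fin m × Fin n, ρc p q = ρ (p.1.castSucc, p.2) (q.1.castSucc, q.2))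
    (hflat : ρ.rank = ρc.rank) :
    (∀ v : Fin (m + 1) × Fin n → ℂ, (∃ x, ρ.mulVec x = v) →
      (∀ (i : Fin m) (j : Fin n), v (i.castSucc, j) = 0) → v = 0) ∧
    (∀ w : Fin m × Fin n → ℂ,
      (∃ x, ρc.mulVec x = w) ↔
        ∃ v : Fin (m + 1) × Fin n → ℂ, (∃ x, ρ.mulVec x = v) ∧
          ∀ p : Fin m × Fin n, v (p.1.castSucc, p.2) = w p) := by
  classical
  let e : Fin m × Fin n → Fin (m + 1) × Fin n := fun p => (p.1.castSucc, p.2)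
  let T := LinearMap.funLeft ℂ ℂ e
  let R := LinearMap.range ρ.mulVecLin
  let S := LinearMap.range ρc.mulVecLin
  have hle : S ≤ R.map T := by
    rintro _ ⟨x, rfl⟩
    refine ⟨ρ.mulVecLin (∑ p, Pi.single (e p) (x p)), ⟨_, rfl⟩, ?_⟩
    ext q
    rw [map_sum]
    simp [T, LinearMap.funLeft_apply, Matrix.mulVec, dotProduct, hc, e, mul_comm]
  have hfin : Module.finrank ℂ R = Module.finrank ℂ S := hflat
  have hmap : Module.finrank ℂ (R.map T) ≤ Module.finrank ℂ R := Submodule.finrank_map_le T R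
  have hS : S = R.map T := Submodule.eq_of_le_of_finrank_le hle (by omega)
  have hker : LinearMap.ker (T.domRestrict R) = ⊥ := by
    have h1 := LinearMap.finrank_range_add_finrank_ker (T.domRestrict R)
    rw [LinearMap.range_domRestrict, ← hS] at h1
    exact Submodule.finrank_eq_zero.mp (by omega)
  refine ⟨?_, ?_⟩
  · rintro v hv h0
    have hvR : v ∈ R := hv
    have : (⟨v, hvR⟩ : R) ∈ LinearMap.ker (T.domRestrict R) := by
      rw [LinearMap.mem_ker]
      ext p
      exact h0 p.1 p.2
    rw [hker, Submodule.mem_bot] at this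
    exact congrArg Subtype.val this
  · intro w
    have h2 : w ∈ S ↔ w ∈ R.map T := by rw [hS]
    refine Iff.trans (show _ ↔ w ∈ S from Iff.rfl) (h2.trans ?_)
    constructor
    · rintro ⟨v, hv, rfl⟩
      exact ⟨v, hv, fun p => rfl⟩
    · rintro ⟨v, hv, h⟩
      exact ⟨v, hv, funext h⟩
end

section
/- For every integer k ≥ 2, the generalized grid state ρ^(k) is PPT: its partial transpose on A, (ρ^(k))^{T_A}, is positive semidefinite. Moreover SN((ρ^(k))^{T_A}) ≤ 2, i.e. the partial transpose decomposes as a finite sum Σ_t v_t v_t* with every v_t of Schmidt rank at most 2. -/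
open Matrix Kronecker ComplexOrder

/-- The generalized grid state `ρ^{(k)}` in local dimensions `(2k-1) × (2k-1)`. -/
noncomputable def grid (k : ℕ) :
    Matrix (Fin (2 * k - 1) × Fin (2 * k - 1)) (Fin (2 * k - 1) × Fin (2 * k - 1)) ℂ :=
  outer (fun p => if (p.1 : ℕ) + (p.2 : ℕ) = k - 1 then 1 else 0)
  + ∑ i : Fin (2 * k - 1), ∑ j : Fin (2 * k - 1),
      (if (i : ℕ) < k ∧ (j : ℕ) < k ∧ k ≤ (i : ℕ) + (j : ℕ) then
        outer (fun p =>
          if ((p.1 : ℕ) = (i : ℕ) ∧ (p.2 : ℕ) = (j : ℕ)) ∨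
             ((p.1 : ℕ) = 2 * k - 1 - (j : ℕ) ∧ (p.2 : ℕ) = 2 * k - 1 - (i : ℕ)) then
            1 else 0)
      else 0)
  + ∑ i : Fin (2 * k - 1), ∑ j : Fin (2 * k - 1),
      (if (i : ℕ) + (j : ℕ) < k - 1 then
        outer (fun p => if (p.1 : ℕ) = (i : ℕ) ∧ (p.2 : ℕ) = (j : ℕ) then 1 else 0)
      else 0)
  + ∑ i : Fin (2 * k - 1),
      (if 1 ≤ (i : ℕ) then
        ((min (i : ℕ) (2 * k - 1 - (i : ℕ)) : ℕ) : ℂ) •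
          outer (fun p =>
            if (p.1 : ℕ) = (i : ℕ) ∧ (p.2 : ℕ) = 2 * k - 1 - (i : ℕ) then 1 else 0)
      else 0)


namespace GridAux

/-- basis vector with natural number labels -/
def V (N a b : ℕ) : Fin N × Fin N → ℂ := fun p => if (p.1 : ℕ) = a ∧ (p.2 : ℕ) = b then 1 else 0

/-- matrix unit -/
def U (N a b c d : ℕ) : Matrix (Fin N × Fin N) (Fin N × Fin N) ℂ :=
  Matrix.of fun p q => V N a b p * V N c d q

lemma star_V (N a b : ℕ) (p) : star (V N a b p) = V N a b p := by
  unfold V; split_ifs <;> simp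

lemma outer_V (N a b : ℕ) : outer (V N a b) = U N a b a b := by
  ext p q; simp only [outer, U, Matrix.of_apply, star_V]

lemma outer_VV (N a b c d : ℕ) : outer (V N a b + V N c d) =
    U N a b a b + U N c d c d + (U N a b c d + U N c d a b) := by
  ext p q
  simp only [outer, U, Matrix.of_apply, Pi.add_apply, star_add, star_V, Matrix.add_apply]
  ring

lemma ptA_U (N a b c d : ℕ) : ptA (U N a b c d) = U N c b a d := by
  ext p q
  simp only [ptA, U, V, Matrix.of_apply, ← ite_and, mul_ite, mul_one, mul_zero]
  congr 1
  apply propext; tauto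

lemma ptA_add {N : ℕ} (A B : Matrix (Fin N × Fin N) (Fin N × Fin N) ℂ) :
    ptA (A + B) = ptA A + ptA B := rfl

lemma ptA_smul {N : ℕ} (c : ℂ) (B : Matrix (Fin N × Fin N) (Fin N × Fin N) ℂ) :
    ptA (c • B) = c • ptA B := rfl

lemma ptA_sum {N : ℕ} {ι : Type*} (s : Finset ι)
    (f : ι → Matrix (Fin N × Fin N) (Fin N × Fin N) ℂ) :
    ptA (∑ i ∈ s, f i) = ∑ i ∈ s, ptA (f i) := by
  ext p q; simp [ptA, Matrix.sum_apply]

lemma sr_V (N a b : ℕ) : (Matrix.of fun i j => V N a b (i, j) : Matrix (Fin N) (Fin N) ℂ) =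
    Matrix.vecMulVec (fun i : Fin N => if (i : ℕ) = a then 1 else 0) (fun i : Fin N => if (i : ℕ) = b then 1 else 0) := by
  ext i j
  simp only [V, Matrix.of_apply, Matrix.vecMulVec_apply, mul_ite, mul_one, mul_zero, ← ite_and]
  congr 1
  apply propext; tauto

lemma rank1 (N a b : ℕ) : schmidtRank (V N a b) ≤ 2 := by
  unfold schmidtRank
  rw [sr_V]
  exact (Matrix.rank_vecMulVec_le _ _).trans (by norm_num)

lemma mat_rank_add {N : ℕ} (X Y : Matrix (Fin N) (Fin N) ℂ) :
    (X + Y).rank ≤ X.rank + Y.rank := by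
  have h := LinearMap.rank_add_le X.mulVecLin Y.mulVecLin
  rw [← Matrix.mulVecLin_add] at h
  unfold Matrix.rank
  simp only [LinearMap.rank, ← Module.finrank_eq_rank] at h
  exact_mod_cast h

lemma rank2 (N a b c d : ℕ) : schmidtRank (V N a b + V N c d) ≤ 2 := by
  unfold schmidtRank
  have : (Matrix.of fun i j => (V N a b + V N c d) (i, j) : Matrix (Fin N) (Fin N) ℂ) =
    (Matrix.of fun i j => V N a b (i, j)) + (Matrix.of fun i j => V N c d (i, j)) := rfl
  rw [this, sr_V, sr_V]
  refine (mat_rank_add _ _).trans ?_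
  have h1 := Matrix.rank_vecMulVec_le (fun i : Fin N => if (i : ℕ) = a then (1:ℂ) else 0)
    (fun i : Fin N => if (i : ℕ) = b then 1 else 0)
  have h2 := Matrix.rank_vecMulVec_le (fun i : Fin N => if (i : ℕ) = c then (1:ℂ) else 0)
    (fun i : Fin N => if (i : ℕ) = d then 1 else 0)
  omega

lemma SNle_outer {N : ℕ} (v : Fin N × Fin N → ℂ) (h : schmidtRank v ≤ 2) : SNle (outer v) 2 :=
  ⟨1, fun _ => v, fun _ => h, by simp⟩

lemma SNle_add {N : ℕ} {A B : Matrix (Fin N × Fin N) (Fin N × Fin N) ℂ}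
    (hA : SNle A 2) (hB : SNle B 2) : SNle (A + B) 2 := by
  obtain ⟨T, v, hv, rfl⟩ := hA
  obtain ⟨S, w, hw, rfl⟩ := hB
  refine ⟨T + S, Fin.append v w, ?_, ?_⟩
  · intro t
    refine Fin.addCases (fun i => ?_) (fun i => ?_) t
    · rw [Fin.append_left]; exact hv i
    · rw [Fin.append_right]; exact hw i
  · rw [Fin.sum_univ_add]; simp

lemma SNle_sum {N : ℕ} {ι : Type*} (s : Finset ι)
    (f : ι → Matrix (Fin N × Fin N) (Fin N × Fin N) ℂ) (h : ∀ i ∈ s, SNle (f i) 2) :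
    SNle (∑ i ∈ s, f i) 2 := by
  classical
  induction s using Finset.induction_on with
  | empty => exact ⟨0, fun i => i.elim0, fun i => i.elim0, by simp⟩
  | insert a s ha ih =>
    rw [Finset.sum_insert ha]
    exact SNle_add (h a (by simp)) (ih fun i hi => h i (by simp [hi]))

lemma SNle_psd {N : ℕ} {A : Matrix (Fin N × Fin N) (Fin N × Fin N) ℂ}
    (hA : SNle A 2) : A.PosSemidef := by
  obtain ⟨T, v, -, rfl⟩ := hA
  refine Matrix.posSemidef_sum _ fun i _ => ?_
  exact Matrix.posSemidef_vecMulVec_self_star (v i)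

/-- index set of the beta vectors, k = K+1 -/
def B (K : ℕ) : Finset (ℕ × ℕ) :=
  (Finset.range (K+1) ×ˢ Finset.range (K+1)).filter fun x => K < x.1 + x.2
/-- index set of the gamma vectors -/
def G (K : ℕ) : Finset (ℕ × ℕ) :=
  (Finset.range (K+1) ×ˢ Finset.range (K+1)).filter fun x => x.1 + x.2 < K
/-- index set of the alpha support -/
def A (K : ℕ) : Finset (ℕ × ℕ) :=
  (Finset.range (K+1) ×ˢ Finset.range (K+1)).filter fun x => x.1 + x.2 = K

lemma sum_G {M : Type*} [AddCommMonoid M] (K : ℕ) (f : ℕ → ℕ → M) :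
    ∑ x ∈ G K, f x.1 x.2 = ∑ x ∈ B K, f (K - x.2) (K - x.1) := by
  refine Finset.sum_bij' (fun x _ => (K - x.2, K - x.1)) (fun x _ => (K - x.2, K - x.1)) ?_ ?_ ?_ ?_ ?_
  · rintro ⟨a, b⟩ h; simp [B, G] at *; omega
  · rintro ⟨a, b⟩ h; simp [B, G] at *; omega
  · rintro ⟨a, b⟩ h; simp [B, G] at *; omega
  · rintro ⟨a, b⟩ h; simp [B, G] at *; omega
  · rintro ⟨a, b⟩ h; simp [B, G] at *
    congr 1 <;> omega

lemma sum_all {M : Type*} [AddCommMonoid M] (K : ℕ) (f : ℕ × ℕ → M) :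
    ∑ x ∈ Finset.range (K+1) ×ˢ Finset.range (K+1), f x =
      ∑ x ∈ A K, f x + (∑ x ∈ G K, f x + ∑ x ∈ B K, f x) := by
  rw [A, G, B, Finset.sum_filter, Finset.sum_filter, Finset.sum_filter, ← Finset.sum_add_distrib,
    ← Finset.sum_add_distrib]
  refine Finset.sum_congr rfl fun x _ => ?_
  rcases lt_trichotomy (x.1 + x.2) K with h | h | h
  · simp [h, h.ne, h.not_gt]
  · simp [h]
  · simp [h, h.ne', h.not_gt]

lemma sum_deg {M : Type*} [AddCommGroup M] [Module ℂ M] (K : ℕ) (D : ℕ → M) :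
    (∑ i ∈ Finset.range (2 * K + 1), if 1 ≤ i then
        ((min i (2 * K + 1 - i) : ℕ) : ℂ) • D i else 0) =
      ∑ x ∈ B K, (D x.1 + D (2 * K + 1 - x.2)) := by
  have card : ∀ i ∈ Finset.range (K+1),
      ((Finset.range (K+1)).filter fun j => K < i + j).card = i := by
    intro i hi
    have : ((Finset.range (K+1)).filter fun j => K < i + j) = Finset.Ico (K + 1 - i) (K + 1) := by
      ext j; simp at *; omega
    rw [this]; simp at *; omega
  have h1 : ∑ x ∈ B K, D x.1 = ∑ i ∈ Finset.range (K+1), (i : ℂ) • D i := by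
    rw [B, Finset.sum_filter, Finset.sum_product]
    refine Finset.sum_congr rfl fun i hi => ?_
    simp only []
    rw [← Finset.sum_filter, Finset.sum_const, card i hi, Nat.cast_smul_eq_nsmul]
  have h2 : ∑ x ∈ B K, D (2 * K + 1 - x.2) =
      ∑ i ∈ Finset.range (K+1), (i : ℂ) • D (2 * K + 1 - i) := by
    rw [B, Finset.sum_filter, Finset.sum_product_right]
    refine Finset.sum_congr rfl fun i hi => ?_
    simp only []
    rw [← Finset.sum_filter, Finset.sum_const]
    simp only [add_comm _ i]
    rw [card i hi, Nat.cast_smul_eq_nsmul]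
  rw [Finset.sum_add_distrib, h1, h2, show 2 * K + 1 = (K + 1) + K by ring, Finset.sum_range_add]
  congr 1
  · refine Finset.sum_congr rfl fun i hi => ?_
    have hi' : i < K + 1 := by simpa using hi
    rw [min_eq_left (by omega)]
    split_ifs with h
    · rfl
    · obtain rfl : i = 0 := by omega
      simp
  · rw [Finset.sum_range_succ', ← Finset.sum_range_reflect]
    simp only [Nat.cast_zero, zero_smul, add_zero]
    refine Finset.sum_congr rfl fun i hi => ?_
    have hi' : i < K := by simpa using hi
    rw [if_pos (by omega), min_eq_right (by omega)]
    congr 2 <;> [congr 1; skip] <;> omega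

lemma alpha_eq (K N : ℕ) (hN : N = 2 * K + 1) :
    (fun p : Fin N × Fin N => if (p.1 : ℕ) + (p.2 : ℕ) = K then (1:ℂ) else 0) =
      fun p => ∑ i ∈ Finset.range (K+1), V N i (K - i) p := by
  funext p
  simp only [V, ite_and, Finset.sum_ite_eq, Finset.mem_range]
  split_ifs <;> first | rfl | omega

lemma ptA_alpha (K N : ℕ) (hN : N = 2 * K + 1) :
    ptA (outer (fun p : Fin N × Fin N => if (p.1 : ℕ) + (p.2 : ℕ) = K then (1:ℂ) else 0)) =
      ∑ x ∈ Finset.range (K+1) ×ˢ Finset.range (K+1), U N x.1 x.2 (K - x.2) (K - x.1) := by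
  have : outer (fun p : Fin N × Fin N => if (p.1 : ℕ) + (p.2 : ℕ) = K then (1:ℂ) else 0) =
      ∑ i ∈ Finset.range (K+1), ∑ j ∈ Finset.range (K+1), U N i (K - i) j (K - j) := by
    rw [alpha_eq K N hN]
    ext p q
    simp only [outer, U, Matrix.of_apply, Matrix.sum_apply, star_sum, star_V, Finset.sum_mul_sum]
  rw [this, Finset.sum_product_right, ← Finset.sum_range_reflect]
  simp only [ptA_sum, ptA_U]
  refine Finset.sum_congr rfl fun i hi => Finset.sum_congr rfl fun j hj => ?_
  simp at hi
  congr 1; omega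

lemma fin_sum {M : Type*} [AddCommMonoid M] (N : ℕ) (f : ℕ → ℕ → M) :
    ∑ i : Fin N, ∑ j : Fin N, f i j = ∑ x ∈ Finset.range N ×ˢ Finset.range N, f x.1 x.2 := by
  rw [Finset.sum_product, ← Fin.sum_univ_eq_sum_range (fun i => ∑ j ∈ Finset.range N, f i j)]
  refine Finset.sum_congr rfl fun i _ => ?_
  rw [← Fin.sum_univ_eq_sum_range (fun j => f i j)]

lemma key (K N : ℕ) (hN : 2 * (K + 1) - 1 = N) :
    ptA (grid (K+1)) = ∑ x ∈ A K, outer (V (2 * (K+1) - 1) x.1 x.2) +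
      ∑ x ∈ B K, (outer (V (2 * (K+1) - 1) x.1 x.2 + V (2 * (K+1) - 1) (K - x.2) (K - x.1)) +
        outer (V (2 * (K+1) - 1) x.1 (N - x.1) + V (2 * (K+1) - 1) (N - x.2) x.2) +
        outer (V (2 * (K+1) - 1) (N - x.2) (N - x.1))) := by
  have hb : (∑ i : Fin (2 * (K+1) - 1), ∑ j : Fin (2 * (K+1) - 1),
      (if (i : ℕ) < (K+1) ∧ (j : ℕ) < (K+1) ∧ (K+1) ≤ (i : ℕ) + (j : ℕ) then
        outer (fun p : Fin (2 * (K+1) - 1) × Fin (2 * (K+1) - 1) =>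
          if ((p.1 : ℕ) = (i : ℕ) ∧ (p.2 : ℕ) = (j : ℕ)) ∨
             ((p.1 : ℕ) = 2 * (K+1) - 1 - (j : ℕ) ∧ (p.2 : ℕ) = 2 * (K+1) - 1 - (i : ℕ)) then
            (1:ℂ) else 0)
      else 0)) = ∑ x ∈ B K, outer (V (2 * (K+1) - 1) x.1 x.2 +
        V (2 * (K+1) - 1) (N - x.2) (N - x.1)) := by
    rw [fin_sum (2 * (K+1) - 1) (fun i j => if i < (K+1) ∧ j < (K+1) ∧ (K+1) ≤ i + j then
        outer (fun p : Fin (2 * (K+1) - 1) × Fin (2 * (K+1) - 1) =>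
          if ((p.1 : ℕ) = i ∧ (p.2 : ℕ) = j) ∨
             ((p.1 : ℕ) = 2 * (K+1) - 1 - j ∧ (p.2 : ℕ) = 2 * (K+1) - 1 - i) then
            (1:ℂ) else 0)
      else 0), ← Finset.sum_filter]
    refine Finset.sum_congr ?_ ?_
    · ext ⟨a, b⟩; simp [B]; omega
    · rintro ⟨a, b⟩ h
      simp [B] at h
      congr 1
      funext p
      simp only [V, Pi.add_apply]
      split_ifs <;> first | omega | simp
  have hg : (∑ i : Fin (2 * (K+1) - 1), ∑ j : Fin (2 * (K+1) - 1),
      (if (i : ℕ) + (j : ℕ) < (K+1) - 1 then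
        outer (fun p : Fin (2 * (K+1) - 1) × Fin (2 * (K+1) - 1) =>
          if (p.1 : ℕ) = (i : ℕ) ∧ (p.2 : ℕ) = (j : ℕ) then (1:ℂ) else 0)
      else 0)) = ∑ x ∈ G K, outer (V (2 * (K+1) - 1) x.1 x.2) := by
    rw [fin_sum (2 * (K+1) - 1) (fun i j => if i + j < (K+1) - 1 then
        outer (fun p : Fin (2 * (K+1) - 1) × Fin (2 * (K+1) - 1) =>
          if (p.1 : ℕ) = i ∧ (p.2 : ℕ) = j then (1:ℂ) else 0) else 0), ← Finset.sum_filter]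
    refine Finset.sum_congr ?_ fun _ _ => rfl
    ext ⟨a, b⟩; simp [G]; omega
  have hd : (∑ i : Fin (2 * (K+1) - 1),
      (if 1 ≤ (i : ℕ) then
        ((min (i : ℕ) (2 * (K+1) - 1 - (i : ℕ)) : ℕ) : ℂ) •
          outer (fun p : Fin (2 * (K+1) - 1) × Fin (2 * (K+1) - 1) =>
            if (p.1 : ℕ) = (i : ℕ) ∧ (p.2 : ℕ) = 2 * (K+1) - 1 - (i : ℕ) then (1:ℂ) else 0)
      else 0)) = ∑ x ∈ B K, (outer (V (2 * (K+1) - 1) x.1 (N - x.1)) +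
        outer (V (2 * (K+1) - 1) (N - x.2) x.2)) := by
    have h := sum_deg K (fun i => outer (V (2 * (K+1) - 1) i (N - i)))
    rw [Fin.sum_univ_eq_sum_range (fun i => if 1 ≤ i then
        ((min i (2 * (K+1) - 1 - i) : ℕ) : ℂ) •
          outer (fun p : Fin (2 * (K+1) - 1) × Fin (2 * (K+1) - 1) =>
            if (p.1 : ℕ) = i ∧ (p.2 : ℕ) = 2 * (K+1) - 1 - i then (1:ℂ) else 0)
      else 0)]
    have e : 2 * K + 1 = N := by omega
    rw [e] at h
    refine Eq.trans ?_ (h.trans ?_)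
    · refine Finset.sum_congr (by rw [hN]) fun i _ => ?_
      subst hN; rfl
    · refine Finset.sum_congr rfl ?_
      rintro ⟨a, b⟩ hx
      simp [B] at hx
      have : N - (N - b) = b := by omega
      simp only [this]
  unfold grid
  rw [hb, hg, hd]
  simp only [ptA_add, Nat.add_sub_cancel]
  rw [ptA_alpha K _ (by omega), sum_all, sum_G K (fun a b => outer (V (2 * (K+1) - 1) a b)),
    sum_G K (fun a b => U (2 * (K+1) - 1) a b (K - b) (K - a))]
  have hA : ∑ x ∈ A K, U (2 * (K+1) - 1) x.1 x.2 (K - x.2) (K - x.1) =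
      ∑ x ∈ A K, outer (V (2 * (K+1) - 1) x.1 x.2) := by
    refine Finset.sum_congr rfl ?_
    rintro ⟨a, b⟩ hx
    simp [A] at hx
    rw [outer_V]
    congr 1 <;> simp only <;> omega
  rw [hA]
  simp only [ptA_sum, ← Finset.sum_add_distrib, add_assoc]
  congr 1
  refine Finset.sum_congr rfl ?_
  rintro ⟨a, b⟩ hx
  simp [B] at hx
  have e1 : K - (K - a) = a := by omega
  have e2 : K - (K - b) = b := by omega
  simp only [outer_V, outer_VV, ptA_add, ptA_U, e1, e2]
  abel

end GridAux

open GridAux in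
/-- For every `k ≥ 2` the generalized grid state `ρ^{(k)}` is PPT, and its partial
transpose on A has Schmidt number at most 2. -/
theorem grid_ppt_and_pt_schmidt_number_le_two (k : ℕ) (hk : 2 ≤ k) :
    (ptA (grid k)).PosSemidef ∧ SNle (ptA (grid k)) 2 := by
  have h : SNle (ptA (grid k)) 2 := by
    obtain ⟨K, rfl⟩ : ∃ K, k = K + 1 := ⟨k - 1, by omega⟩
    rw [key K _ rfl]
    refine SNle_add (SNle_sum _ _ fun x _ => SNle_outer _ (rank1 _ _ _))
      (SNle_sum _ _ fun x _ => SNle_add (SNle_add ?_ ?_) ?_)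
    · exact SNle_outer _ (rank2 _ _ _ _ _)
    · exact SNle_outer _ (rank2 _ _ _ _ _)
    · exact SNle_outer _ (rank1 _ _ _)
  exact ⟨SNle_psd h, h⟩
end

section
/- There exists a positive semidefinite matrix ρ indexed by Fin 7 × Fin 7 over ℂ such that ρ is PPT, SN(ρ) ≤ 4, and ¬(SN(ρ) ≤ 3); that is, in local dimensions 7 × 7 a PPT state of Schmidt number exactly 4 exists. -/
open Matrix Kronecker ComplexOrder

namespace PPT7

/-- label pattern; `0` means absent -/
def lab (p : Fin 7 × Fin 7) : Fin 15 :=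
  (![![0, 0, 4, 0, 6, 13, 12], ![0, 0, 0, 0, 7, 6, 13], ![0, 0, 2, 0, 4, 7, 6],
    ![3, 8, 5, 1, 2, 4, 7], ![0, 9, 8, 5, 1, 2, 4], ![11, 10, 3, 8, 5, 1, 2],
    ![14, 11, 10, 9, 3, 5, 1]] : Fin 7 → Fin 7 → Fin 15) p.1 p.2

def wt (l : Fin 15) : ℕ :=
  (![0, 0, 0, 6, 3, 1, 14, 8, 3, 11, 14, 24, 36, 24, 38] : Fin 15 → ℕ) l

def amp (l : Fin 15) : ℕ := if l = 0 then 0 else 4 ^ wt l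

def vec (l : Fin 15) (p : Fin 7 × Fin 7) : ℂ := if lab p = l then (amp l : ℂ) else 0

def R (p q : Fin 7 × Fin 7) : ℕ := if lab p = lab q then amp (lab p) ^ 2 else 0

def sc (p : Fin 7 × Fin 7) : ℕ := 4 ^ (40 - wt (lab p))

def C (p q : Fin 7 × Fin 7) : ℕ := R (p.1, q.2) (q.1, p.2) * sc p * sc q

def rho : Matrix (Fin 7 × Fin 7) (Fin 7 × Fin 7) ℂ := ∑ l, outer (vec l)

lemma rho_apply (p q) : rho p q = (R p q : ℂ) := by
  simp only [rho, Matrix.sum_apply, outer, vec, Matrix.of_apply, R]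
  rw [Finset.sum_eq_single (lab p)]
  · by_cases h : lab p = lab q
    · simp [h, sq]
    · have h' : ¬ lab q = lab p := fun e => h e.symm
      simp [h, h']
  · intro l _ hl
    simp [Ne.symm hl]
  · simp

lemma outer_psd (v : Fin 7 × Fin 7 → ℂ) : (outer v).PosSemidef := by
  have := Matrix.posSemidef_vecMulVec_self_star v
  exact this

lemma rho_psd : rho.PosSemidef :=
  Matrix.posSemidef_sum _ fun l _ => outer_psd (vec l)

lemma lap_psd {ι : Type*} [Fintype ι] [DecidableEq ι] (O : ι → ι → ℝ)
    (hs : ∀ p q, O p q = O q p) (h0 : ∀ p q, 0 ≤ O p q) :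
    (Matrix.diagonal (fun p => ((∑ q, O p q : ℝ) : ℂ)) +
      Matrix.of (fun p q => (O p q : ℂ))).PosSemidef := by
  rw [Matrix.posSemidef_iff_dotProduct_mulVec]
  refine ⟨?_, fun x => ?_⟩
  · refine Matrix.IsHermitian.add ?_ ?_
    · rw [Matrix.isHermitian_diagonal_iff]
      intro p
      simp [IsSelfAdjoint]
    · ext p q
      simp [hs p q]
  · have key : star x ⬝ᵥ ((Matrix.diagonal (fun p => ((∑ q, O p q : ℝ) : ℂ)) +
      Matrix.of (fun p q => (O p q : ℂ))) *ᵥ x) =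
      ∑ p, ∑ q, (O p q / 2 : ℂ) * (star (x p + x q) * (x p + x q)) := by
      have e1 : ∑ p, ∑ q, (O p q / 2 : ℂ) * (star (x q) * x q) =
          ∑ p, ∑ q, (O p q / 2 : ℂ) * (star (x p) * x p) := by
        rw [Finset.sum_comm]
        refine Finset.sum_congr rfl fun p _ => Finset.sum_congr rfl fun q _ => ?_
        rw [hs]
      have e2 : ∑ p, ∑ q, (O p q / 2 : ℂ) * (star (x q) * x p) =
          ∑ p, ∑ q, (O p q / 2 : ℂ) * (star (x p) * x q) := by
        rw [Finset.sum_comm]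
        refine Finset.sum_congr rfl fun p _ => Finset.sum_congr rfl fun q _ => ?_
        rw [hs]
      have e3 : ∑ p, ∑ q, (O p q / 2 : ℂ) * (star (x p + x q) * (x p + x q)) =
          (∑ p, ∑ q, (O p q / 2 : ℂ) * (star (x p) * x p) +
          ∑ p, ∑ q, (O p q / 2 : ℂ) * (star (x q) * x q)) +
          (∑ p, ∑ q, (O p q / 2 : ℂ) * (star (x p) * x q) +
          ∑ p, ∑ q, (O p q / 2 : ℂ) * (star (x q) * x p)) := by
        simp only [← Finset.sum_add_distrib]
        refine Finset.sum_congr rfl fun p _ => Finset.sum_congr rfl fun q _ => ?_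
        rw [star_add]; ring
      rw [e3, e1, e2, Matrix.add_mulVec, dotProduct_add]
      congr 1
      · simp only [dotProduct, Matrix.mulVec_diagonal, Pi.star_apply, ← Finset.sum_add_distrib]
        refine Finset.sum_congr rfl fun p _ => ?_
        push_cast
        rw [Finset.sum_mul, Finset.mul_sum]
        refine Finset.sum_congr rfl fun q _ => ?_
        ring
      · simp only [dotProduct, Matrix.mulVec, Pi.star_apply, ← Finset.sum_add_distrib,
          Finset.mul_sum, Matrix.of_apply]
        refine Finset.sum_congr rfl fun p _ => Finset.sum_congr rfl fun q _ => ?_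
        ring
    rw [key]
    refine Finset.sum_nonneg fun p _ => Finset.sum_nonneg fun q _ => ?_
    refine mul_nonneg ?_ (star_mul_self_nonneg _)
    have : (0:ℝ) ≤ O p q / 2 := by have := h0 p q; positivity
    have h2 : ((O p q / 2 : ℝ) : ℂ) = (O p q / 2 : ℂ) := by push_cast; rfl
    rw [← h2]
    exact_mod_cast this

lemma dom : ∀ p, ∑ q, (if p = q then 0 else C p q) ≤ C p p := by
  decide +kernel

lemma Csymm (p q) : C p q = C q p := by
  simp only [C, R]
  by_cases h : lab (p.1, q.2) = lab (q.1, p.2)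
  · simp [h]; ring
  · simp [h, Ne.symm h]

lemma Cpsd : (Matrix.of fun p q => (C p q : ℂ)).PosSemidef := by
  have h1 := lap_psd (fun p q => if p = q then 0 else (C p q : ℝ))
    (fun p q => by simp only [Csymm p q, eq_comm]) (fun p q => by positivity)
  have h2 : (Matrix.diagonal fun p : Fin 7 × Fin 7 =>
      ((C p p - ∑ q, (if p = q then 0 else C p q : ℝ) : ℝ) : ℂ)).PosSemidef := by
    refine Matrix.PosSemidef.diagonal fun p => ?_
    have := dom p
    have h3 : ((∑ q, (if p = q then 0 else C p q) : ℕ) : ℝ) ≤ (C p p : ℝ) :=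
      Nat.cast_le.mpr this
    push_cast at h3
    have h4 : (0:ℝ) ≤ (C p p - ∑ q, (if p = q then 0 else C p q : ℝ) : ℝ) := by linarith
    exact Complex.zero_le_real.mpr h4
  have h3 := h2.add h1
  convert h3 using 1
  ext p q
  by_cases h : p = q
  · subst h; simp
  · simp [h]

lemma pt_psd : (ptB rho).PosSemidef := by
  have h := Cpsd.conjTranspose_mul_mul_same (Matrix.diagonal fun p => ((sc p : ℂ))⁻¹)
  convert h using 1
  ext p q
  have h1 : (sc p : ℂ) ≠ 0 := by simp [sc]
  have h2 : (sc q : ℂ) ≠ 0 := by simp [sc]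
  simp [Matrix.diagonal_mul, Matrix.mul_diagonal, ptB, rho_apply, C, Matrix.diagonal_conjTranspose]
  field_simp

def rows (l : Fin 15) : Finset (Fin 7) :=
  Finset.univ.filter fun i => l ≠ 0 ∧ ∃ j, lab (i, j) = l

lemma rows_card : ∀ l, (rows l).card ≤ 4 := by decide +kernel

lemma vec_rank (l : Fin 15) : schmidtRank (vec l) ≤ 4 := by
  unfold schmidtRank
  set M : Matrix (Fin 7) (Fin 7) ℂ := Matrix.of fun i j => vec l (i, j) with hM
  have h : M = Matrix.diagonal (fun i => if i ∈ rows l then (1:ℂ) else 0) * M := by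
    ext i j
    rw [Matrix.diagonal_mul]
    by_cases hi : i ∈ rows l
    · simp [hi]
    · have : M i j = 0 := by
        simp only [rows, Finset.mem_filter, Finset.mem_univ, true_and, not_and, not_exists] at hi
        simp only [hM, Matrix.of_apply, vec]
        split_ifs with hl
        · by_cases h0 : l = 0
          · simp [amp, h0]
          · exact absurd hl (hi h0 j)
        · rfl
      simp [this]
  rw [h]
  refine (Matrix.rank_mul_le_left _ _).trans ?_
  rw [Matrix.rank_diagonal]
  refine le_trans (le_of_eq ?_) (rows_card l)
  rw [Fintype.card_subtype]
  congr 1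
  ext i
  simp

lemma sn4 : SNle rho 4 := ⟨15, vec, vec_rank, rfl⟩

lemma minors (M : Matrix (Fin 7) (Fin 7) ℂ) (h : M.rank ≤ 3) (r c : Fin 4 → Fin 7) :
    (M.submatrix r c).det = 0 := by
  by_contra hd
  have hu : IsUnit (M.submatrix r c) := by
    rw [Matrix.isUnit_iff_isUnit_det]; exact isUnit_iff_ne_zero.mpr hd
  have h1 := Matrix.rank_of_isUnit _ hu
  have h2 := Matrix.rank_submatrix_le M r c
  simp at h1
  omega


set_option maxHeartbeats 2000000 in
lemma alg (a b c d e f g h i j k l m n : ℂ) (M : Matrix (Fin 7) (Fin 7) ℂ)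
    (hM : M = !![0, 0, d, 0, f, m, l; 0, 0, 0, 0, g, f, m; 0, 0, b, 0, d, g, f; c, h, e, a, b, d, g; 0, i, h, e, a, b, d; k, j, c, h, e, a, b; n, k, j, i, c, e, a])
    (hr : M.rank ≤ 3) : e = 0 := by
  have H := minors M hr
  subst hM
  clear hr
  have det4 : ∀ A : Matrix (Fin 4) (Fin 4) ℂ, A.det =
      A 0 0 * (A 1 1 * (A 2 2 * A 3 3 - A 2 3 * A 3 2) - A 1 2 * (A 2 1 * A 3 3 - A 2 3 * A 3 1)
        + A 1 3 * (A 2 1 * A 3 2 - A 2 2 * A 3 1))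
      - A 0 1 * (A 1 0 * (A 2 2 * A 3 3 - A 2 3 * A 3 2) - A 1 2 * (A 2 0 * A 3 3 - A 2 3 * A 3 0)
        + A 1 3 * (A 2 0 * A 3 2 - A 2 2 * A 3 0))
      + A 0 2 * (A 1 0 * (A 2 1 * A 3 3 - A 2 3 * A 3 1) - A 1 1 * (A 2 0 * A 3 3 - A 2 3 * A 3 0)
        + A 1 3 * (A 2 0 * A 3 1 - A 2 1 * A 3 0))
      - A 0 3 * (A 1 0 * (A 2 1 * A 3 2 - A 2 2 * A 3 1) - A 1 1 * (A 2 0 * A 3 2 - A 2 2 * A 3 0)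
        + A 1 2 * (A 2 0 * A 3 1 - A 2 1 * A 3 0)) := by
    intro A
    simp [Matrix.det_succ_row_zero, Fin.sum_univ_succ, Fin.succAbove]
    ring
  simp only [det4] at H
  have h00 : (d * f) * (c * e) = 0 := by
    have := H ![0, 1, 3, 4] ![2, 5, 0, 3]
    simp [-mul_eq_zero, -neg_eq_zero] at this
    first
      | linear_combination this
      | linear_combination -this
  have h01 : (d * f) * (k * e) = 0 := by
    have := H ![0, 1, 4, 5] ![2, 5, 0, 3]
    simp [-mul_eq_zero, -neg_eq_zero] at this
    first
      | linear_combination this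
      | linear_combination -this
  have h02 : (d * f) * (i * i - e * k) = 0 := by
    have := H ![0, 1, 4, 6] ![2, 5, 1, 3]
    simp [-mul_eq_zero, -neg_eq_zero] at this
    first
      | linear_combination this
      | linear_combination -this
  have h03 : (d * f) * (h * e - a * i) = 0 := by
    have := H ![0, 1, 3, 4] ![2, 5, 1, 3]
    simp [-mul_eq_zero, -neg_eq_zero] at this
    first
      | linear_combination this
      | linear_combination -this
  have h04 : (d * f) * (i * h - e * j) = 0 := by
    have := H ![0, 1, 4, 5] ![2, 5, 1, 3]
    simp [-mul_eq_zero, -neg_eq_zero] at this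
    first
      | linear_combination this
      | linear_combination -this
  have h10 : (g * g - f * d) * (c * e) = 0 := by
    have := H ![1, 2, 3, 4] ![4, 5, 0, 3]
    simp [-mul_eq_zero, -neg_eq_zero] at this
    first
      | linear_combination this
      | linear_combination -this
  have h11 : (g * g - f * d) * (k * e) = 0 := by
    have := H ![1, 2, 4, 5] ![4, 5, 0, 3]
    simp [-mul_eq_zero, -neg_eq_zero] at this
    first
      | linear_combination this
      | linear_combination -this
  have h12 : (g * g - f * d) * (i * i - e * k) = 0 := by
    have := H ![1, 2, 4, 6] ![4, 5, 1, 3]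
    simp [-mul_eq_zero, -neg_eq_zero] at this
    first
      | linear_combination this
      | linear_combination -this
  have h13 : (g * g - f * d) * (h * e - a * i) = 0 := by
    have := H ![1, 2, 3, 4] ![4, 5, 1, 3]
    simp [-mul_eq_zero, -neg_eq_zero] at this
    first
      | linear_combination this
      | linear_combination -this
  have h14 : (g * g - f * d) * (i * h - e * j) = 0 := by
    have := H ![1, 2, 4, 5] ![4, 5, 1, 3]
    simp [-mul_eq_zero, -neg_eq_zero] at this
    first
      | linear_combination this
      | linear_combination -this
  have h20 : (f * f - m * g) * (c * e) = 0 := by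
    have := H ![0, 1, 3, 4] ![4, 5, 0, 3]
    simp [-mul_eq_zero, -neg_eq_zero] at this
    first
      | linear_combination this
      | linear_combination -this
  have h21 : (f * f - m * g) * (k * e) = 0 := by
    have := H ![0, 1, 4, 5] ![4, 5, 0, 3]
    simp [-mul_eq_zero, -neg_eq_zero] at this
    first
      | linear_combination this
      | linear_combination -this
  have h22 : (f * f - m * g) * (i * i - e * k) = 0 := by
    have := H ![0, 1, 4, 6] ![4, 5, 1, 3]
    simp [-mul_eq_zero, -neg_eq_zero] at this
    first
      | linear_combination this
      | linear_combination -this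
  have h23 : (f * f - m * g) * (h * e - a * i) = 0 := by
    have := H ![0, 1, 3, 4] ![4, 5, 1, 3]
    simp [-mul_eq_zero, -neg_eq_zero] at this
    first
      | linear_combination this
      | linear_combination -this
  have h24 : (f * f - m * g) * (i * h - e * j) = 0 := by
    have := H ![0, 1, 4, 5] ![4, 5, 1, 3]
    simp [-mul_eq_zero, -neg_eq_zero] at this
    first
      | linear_combination this
      | linear_combination -this
  have h30 : (d * d - f * b) * (c * e) = 0 := by
    have := H ![0, 2, 3, 4] ![2, 4, 0, 3]
    simp [-mul_eq_zero, -neg_eq_zero] at this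
    first
      | linear_combination this
      | linear_combination -this
  have h31 : (d * d - f * b) * (k * e) = 0 := by
    have := H ![0, 2, 4, 5] ![2, 4, 0, 3]
    simp [-mul_eq_zero, -neg_eq_zero] at this
    first
      | linear_combination this
      | linear_combination -this
  have h32 : (d * d - f * b) * (i * i - e * k) = 0 := by
    have := H ![0, 2, 4, 6] ![2, 4, 1, 3]
    simp [-mul_eq_zero, -neg_eq_zero] at this
    first
      | linear_combination this
      | linear_combination -this
  have h33 : (d * d - f * b) * (h * e - a * i) = 0 := by
    have := H ![0, 2, 3, 4] ![2, 4, 1, 3]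
    simp [-mul_eq_zero, -neg_eq_zero] at this
    first
      | linear_combination this
      | linear_combination -this
  have h34 : (d * d - f * b) * (i * h - e * j) = 0 := by
    have := H ![0, 2, 4, 5] ![2, 4, 1, 3]
    simp [-mul_eq_zero, -neg_eq_zero] at this
    first
      | linear_combination this
      | linear_combination -this
  have hb := H ![2, 3, 4, 5] ![2, 4, 5, 6]
  have ha := H ![3, 4, 5, 6] ![3, 4, 5, 6]
  have he := H ![3, 4, 5, 6] ![2, 3, 4, 5]
  clear H
  simp [-mul_eq_zero, -neg_eq_zero] at ha hb he
  by_contra hne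
  by_cases hU : d * f = 0 ∧ g * g - f * d = 0 ∧ f * f - m * g = 0 ∧ d * d - f * b = 0
  · obtain ⟨u0, u1, u2, u3⟩ := hU
    have g0 : g = 0 := by
      have : g * g = 0 := by linear_combination u1 + u0
      simpa using this
    subst g0
    have f0 : f = 0 := by
      have : f * f = 0 := by linear_combination u2
      simpa using this
    subst f0
    have d0 : d = 0 := by
      have : d * d = 0 := by linear_combination u3
      simpa using this
    subst d0
    have b0 : b = 0 := by
      have : b ^ 4 = 0 := by linear_combination hb
      simpa using this
    subst b0
    have a0 : a = 0 := by
      have : a ^ 4 = 0 := by linear_combination ha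
      simpa using this
    subst a0
    have : e ^ 4 = 0 := by linear_combination he
    exact hne (by simpa using this)
  · have hL : c * e = 0 ∧ k * e = 0 ∧ i * i - e * k = 0 ∧ h * e - a * i = 0 ∧
        i * h - e * j = 0 := by
      have key : ∀ z, (d * f) * z = 0 → (g * g - f * d) * z = 0 → (f * f - m * g) * z = 0 →
          (d * d - f * b) * z = 0 → z = 0 := by
        intro z z0 z1 z2 z3
        by_contra hz
        exact hU ⟨(mul_eq_zero.1 z0).resolve_right hz, (mul_eq_zero.1 z1).resolve_right hz,
          (mul_eq_zero.1 z2).resolve_right hz, (mul_eq_zero.1 z3).resolve_right hz⟩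
      exact ⟨key _ h00 h10 h20 h30, key _ h01 h11 h21 h31, key _ h02 h12 h22 h32, key _ h03 h13 h23 h33, key _ h04 h14 h24 h34⟩
    obtain ⟨l0, l1, l2, l3, l4⟩ := hL
    have c0 : c = 0 := by simpa [hne] using l0
    have k0 : k = 0 := by simpa [hne] using l1
    subst c0 k0
    have i0 : i = 0 := by
      have : i * i = 0 := by linear_combination l2
      simpa using this
    subst i0
    have h0 : h = 0 := by
      have : h * e = 0 := by linear_combination l3
      simpa [hne] using this
    subst h0
    have j0 : j = 0 := by
      have : j * e = 0 := by linear_combination -l4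
      simpa [hne] using this
    subst j0
    have : e ^ 4 = 0 := by linear_combination he
    exact hne (by simpa using this)

lemma not_sn3 : ¬ SNle rho 3 := by
  rintro ⟨T, v, hv, hρ⟩
  have hent : ∀ p q, (R p q : ℂ) = ∑ t, v t p * star (v t q) := by
    intro p q
    rw [← rho_apply, hρ]
    simp [Matrix.sum_apply, outer]
  have hz : ∀ w : Fin T → ℂ, ∑ t, w t * star (w t) = 0 → ∀ t, w t = 0 := by
    intro w hw t
    have := (Finset.sum_eq_zero_iff_of_nonneg
      (fun t _ => mul_star_self_nonneg (w t))).1 hw t (Finset.mem_univ t)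
    simpa using this
  have habs : ∀ p, lab p = 0 → ∀ t, v t p = 0 := by
    intro p hp
    refine hz (fun t => v t p) ?_
    rw [← hent p p]
    simp [R, hp, amp]
  have heq : ∀ p q, lab p = lab q → ∀ t, v t p = v t q := by
    intro p q hpq t
    have := hz (fun t => v t p - v t q) (by
      have : ∑ t, (v t p - v t q) * star (v t p - v t q) =
          (∑ t, v t p * star (v t p) - ∑ t, v t p * star (v t q)) -
          (∑ t, v t q * star (v t p) - ∑ t, v t q * star (v t q)) := by
        simp only [← Finset.sum_sub_distrib]
        refine Finset.sum_congr rfl fun t _ => ?_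
        rw [star_sub]; ring
      rw [this, ← hent, ← hent, ← hent, ← hent]
      simp [R, hpq]) t
    exact sub_eq_zero.1 this
  have h5 : ∀ t, v t (3, 2) = 0 := by
    intro t
    refine alg (v t (3, 3)) (v t (2, 2)) (v t (3, 0)) (v t (0, 2)) (v t (3, 2)) (v t (0, 4))
      (v t (1, 4)) (v t (3, 1)) (v t (4, 1)) (v t (5, 1)) (v t (5, 0)) (v t (0, 6)) (v t (0, 5))
      (v t (6, 0)) (Matrix.of fun i j => v t (i, j)) ?_ (hv t)
    ext i j
    fin_cases i <;> fin_cases j <;>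
      first
      | exact habs _ (by decide) t
      | exact heq _ _ (by decide) t
  have h := hent (3, 2) (3, 2)
  simp [h5, R] at h
  revert h
  decide

end PPT7

/-- In local dimensions 7 × 7 a PPT state of Schmidt number exactly 4 exists. -/
theorem exists_ppt_7x7_schmidt_number_four :
    ∃ ρ : Matrix (Fin 7 × Fin 7) (Fin 7 × Fin 7) ℂ,
      ρ.PosSemidef ∧ (ptB ρ).PosSemidef ∧ SNle ρ 4 ∧ ¬ SNle ρ 3 := by
  exact ⟨PPT7.rho, PPT7.rho_psd, PPT7.pt_psd, PPT7.sn4, PPT7.not_sn3⟩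
end
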